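/- arXiv:2012.13610 — 2 statements merged into one kernel-verified Lean document; each statement's English description precedes it below -/
import Mathlib

section
/- Let Q̂ satisfy S Q̂ = Â_ΓΓ Q̂ Λ̂ with Λ̂ diagonal, D̂ = I - Λ̂, P̂ = -A_II^{-1} A_IΓ Q̂, and let Π̂_S u = Q̂(Q̂^T Â_ΓΓ Q̂)^{-1} Q̂^T Â_ΓΓ u. Then the energy of the inexact extension R̂_0 u = (u, P̂ (Q̂^T Â_ΓΓ Q̂)^{-1} Q̂^T Â_ΓΓ u) with respect to A satisfies (R̂_0 u)^T A (R̂_0 v) = (Π̂_S v)^T S (Π̂_S u) + (v - Π̂_S v)^T A_ΓΓ (u - Π̂_S u). -/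
open Matrix

/-- The bilinear form of a symmetric block matrix on vectors whose second components are
discrete harmonic extensions of `a` and `b`, rather than of `u` and `v`. -/
theorem Matrix.sumElim_dotProduct_fromBlocks_mulVec_sumElim
    {p q : Type*} [Fintype p] [Fintype q] [DecidableEq q]
    (A : Matrix p p ℝ) (B : Matrix p q ℝ) {C : Matrix q q ℝ}
    (hCsymm : C.IsSymm) (hC : IsUnit C.det) (u v a b : p → ℝ) :
    Sum.elim v (-((C⁻¹ * Bᵀ) *ᵥ b)) ⬝ᵥ
        (Matrix.fromBlocks A B Bᵀ C *ᵥ Sum.elim u (-((C⁻¹ * Bᵀ) *ᵥ a))) =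
      v ⬝ᵥ (A *ᵥ u) - v ⬝ᵥ ((B * C⁻¹ * Bᵀ) *ᵥ a) - b ⬝ᵥ ((B * C⁻¹ * Bᵀ) *ᵥ u) +
        b ⬝ᵥ ((B * C⁻¹ * Bᵀ) *ᵥ a) := by
  have hinv : C⁻¹ᵀ = C⁻¹ := by rw [Matrix.transpose_nonsing_inv, hCsymm.eq]
  have hadj : ∀ x : q → ℝ, ((C⁻¹ * Bᵀ) *ᵥ b) ⬝ᵥ x = b ⬝ᵥ ((B * C⁻¹) *ᵥ x) := fun x => by
    rw [dotProduct_mulVec, ← mulVec_transpose, transpose_mul, hinv]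
  have hcancel : C *ᵥ ((C⁻¹ * Bᵀ) *ᵥ a) = Bᵀ *ᵥ a := by
    rw [mulVec_mulVec, ← Matrix.mul_assoc, Matrix.mul_nonsing_inv _ hC, Matrix.one_mul]
  rw [fromBlocks_mulVec, sumElim_dotProduct_sumElim]
  simp only [Sum.elim_comp_inl, Sum.elim_comp_inr, mulVec_neg, hcancel, neg_dotProduct,
    dotProduct_add, dotProduct_neg, hadj, mulVec_mulVec, Matrix.mul_assoc]
  ring

/-- A vector `M`-orthogonal to the columns of `Q` is `S`-orthogonal to the range of `Q`, when those
columns are generalized eigenvectors of the pencil `(S, M)`. -/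
theorem Matrix.dotProduct_mulVec_eq_zero_of_generalized_eigenvectors
    {p k : Type*} [Fintype p] [Fintype k] [DecidableEq k]
    {S M : Matrix p p ℝ} {Q : Matrix p k ℝ} {l : k → ℝ} (hM : M.IsSymm)
    (heig : S * Q = M * Q * Matrix.diagonal l) {w : p → ℝ} (hw : Qᵀ *ᵥ (M *ᵥ w) = 0)
    (c : k → ℝ) : w ⬝ᵥ (S *ᵥ (Q *ᵥ c)) = 0 := by
  rw [mulVec_mulVec, heig, ← mulVec_mulVec, dotProduct_mulVec, ← mulVec_transpose, transpose_mul,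
    hM.eq, ← mulVec_mulVec, hw, zero_dotProduct]

/-- The residual of the `M`-projection onto the range of `Q` is `M`-orthogonal to the columns
of `Q`. -/
theorem Matrix.transpose_mulVec_mulVec_sub_projection
    {p k : Type*} [Fintype p] [Fintype k] [DecidableEq k]
    {M : Matrix p p ℝ} {Q : Matrix p k ℝ} (hQ : IsUnit (Qᵀ * M * Q).det) (w : p → ℝ) :
    Qᵀ *ᵥ (M *ᵥ (w - Q *ᵥ ((Qᵀ * M * Q)⁻¹ *ᵥ (Qᵀ *ᵥ (M *ᵥ w))))) = 0 := by
  have hG (x : k → ℝ) : Qᵀ *ᵥ (M *ᵥ (Q *ᵥ x)) = (Qᵀ * M * Q) *ᵥ x := by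
    simp only [mulVec_mulVec, Matrix.mul_assoc]
  rw [mulVec_sub, mulVec_sub, hG, mulVec_mulVec _ (Qᵀ * M * Q), Matrix.mul_nonsing_inv _ hQ,
    one_mulVec, sub_self]

/-- Lemma 4.2 of the paper: the `A`-energy of the inexact coarse
extension decomposes into the Schur energy of the `Â_ΓΓ`-projection plus the
`A_ΓΓ`-energy of the complement. -/
theorem inexact_extension_energy_decomposition
    {p q k : Type*} [Fintype p] [Fintype q] [Fintype k]
    [DecidableEq p] [DecidableEq q] [DecidableEq k]
    (AΓΓ : Matrix p p ℝ) (AΓI : Matrix p q ℝ) (AII : Matrix q q ℝ)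
    (hAsym : (Matrix.fromBlocks AΓΓ AΓI AΓIᵀ AII).IsSymm)
    (hAII : AII.PosDef)
    (Ahat : Matrix p p ℝ) (hAhat : Ahat.PosDef)
    (Qhat : Matrix p k ℝ) (l : k → ℝ)
    (heig : (AΓΓ - AΓI * AII⁻¹ * AΓIᵀ) * Qhat = Ahat * Qhat * Matrix.diagonal l)
    (hQrank : LinearIndependent ℝ (fun j => (Qhatᵀ j : p → ℝ)))
    (hQinv : IsUnit (Qhatᵀ * Ahat * Qhat).det)
    (u v : p → ℝ) :
    Sum.elim v ((-(AII⁻¹ * AΓIᵀ * Qhat)) *ᵥ ((Qhatᵀ * Ahat * Qhat)⁻¹ *ᵥ (Qhatᵀ *ᵥ (Ahat *ᵥ v)))) ⬝ᵥ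
        (Matrix.fromBlocks AΓΓ AΓI AΓIᵀ AII *ᵥ
          Sum.elim u ((-(AII⁻¹ * AΓIᵀ * Qhat)) *ᵥ
            ((Qhatᵀ * Ahat * Qhat)⁻¹ *ᵥ (Qhatᵀ *ᵥ (Ahat *ᵥ u))))) =
      (Qhat *ᵥ ((Qhatᵀ * Ahat * Qhat)⁻¹ *ᵥ (Qhatᵀ *ᵥ (Ahat *ᵥ v)))) ⬝ᵥ
          ((AΓΓ - AΓI * AII⁻¹ * AΓIᵀ) *ᵥ
            (Qhat *ᵥ ((Qhatᵀ * Ahat * Qhat)⁻¹ *ᵥ (Qhatᵀ *ᵥ (Ahat *ᵥ u))))) +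
        (v - Qhat *ᵥ ((Qhatᵀ * Ahat * Qhat)⁻¹ *ᵥ (Qhatᵀ *ᵥ (Ahat *ᵥ v)))) ⬝ᵥ
          (AΓΓ *ᵥ (u - Qhat *ᵥ ((Qhatᵀ * Ahat * Qhat)⁻¹ *ᵥ (Qhatᵀ *ᵥ (Ahat *ᵥ u))))) := by
  have hAhat_symm : Ahat.IsSymm := by simpa [IsHermitian, IsSymm] using hAhat.isHermitian
  have hAII_symm : AII.IsSymm := by simpa [IsHermitian, IsSymm] using hAII.isHermitian
  have hAII_det : IsUnit AII.det := hAII.det_pos.ne'.isUnit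
  have hAΓΓ_symm : AΓΓ.IsSymm := (isSymm_fromBlocks_iff.mp hAsym).1
  have hS_symm : (AΓΓ - AΓI * AII⁻¹ * AΓIᵀ).IsSymm := by
    rw [IsSymm, transpose_sub, transpose_mul, transpose_mul, transpose_transpose,
      transpose_nonsing_inv, hAII_symm.eq, hAΓΓ_symm.eq, Matrix.mul_assoc]
  have hu := Matrix.transpose_mulVec_mulVec_sub_projection hQinv u
  have hv := Matrix.transpose_mulVec_mulVec_sub_projection hQinv v
  generalize (Qhatᵀ * Ahat * Qhat)⁻¹ *ᵥ (Qhatᵀ *ᵥ (Ahat *ᵥ u)) = c at hu ⊢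
  generalize (Qhatᵀ * Ahat * Qhat)⁻¹ *ᵥ (Qhatᵀ *ᵥ (Ahat *ᵥ v)) = d at hv ⊢
  have hvc := Matrix.dotProduct_mulVec_eq_zero_of_generalized_eigenvectors hAhat_symm heig hv c
  have hud := Matrix.dotProduct_mulVec_eq_zero_of_generalized_eigenvectors hAhat_symm heig hu d
  rw [dotProduct_mulVec, ← mulVec_transpose, hS_symm.eq, dotProduct_comm] at hud
  rw [neg_mulVec, neg_mulVec, ← mulVec_mulVec c (AII⁻¹ * AΓIᵀ), ← mulVec_mulVec d (AII⁻¹ * AΓIᵀ),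
    Matrix.sumElim_dotProduct_fromBlocks_mulVec_sumElim AΓΓ AΓI hAII_symm hAII_det]
  simp only [sub_mulVec, mulVec_sub, sub_dotProduct, dotProduct_sub] at hvc hud ⊢
  linarith
end

section
/- Abstract additive Schwarz condition number bound: suppose bilinear forms a_i on spaces V_i with extension operators R_i^T satisfy (i) stable decomposition: every u admits u = Σ_i R_i^T u_i with Σ_i a_i(u_i,u_i) ≤ C_0^2 a(u,u); (ii) strengthened Cauchy–Schwarz with spectral radius μ(ε); (iii) local stability a(R_i^T u_i, R_i^T u_i) ≤ ω a_i(u_i,u_i). Then the additive Schwarz operator T = Σ_i R_i^T Ã_i^{-1} R_i A satisfies C_0^{-2} a(u,u) ≤ a(Tu,u) ≤ ω(μ(ε)+1) a(u,u) for all u. -/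
open Matrix

/-- Young's inequality for the form of a real positive definite matrix. -/
theorem Matrix.PosDef.two_mul_dotProduct_mulVec_le {n : Type*} [Fintype n]
    {B : Matrix n n ℝ} (hB : B.PosDef) (x y : n → ℝ) (k : ℝ) :
    2 * k * (x ⬝ᵥ (B *ᵥ y)) ≤ x ⬝ᵥ (B *ᵥ x) + k ^ 2 * (y ⬝ᵥ (B *ᵥ y)) := by
  have hT : Bᵀ = B := by simpa using hB.isHermitian.eq
  have hsymm : y ⬝ᵥ (B *ᵥ x) = x ⬝ᵥ (B *ᵥ y) := by
    rw [dotProduct_mulVec, ← mulVec_transpose, hT, dotProduct_comm]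
  have h : 0 ≤ (x - k • y) ⬝ᵥ (B *ᵥ (x - k • y)) := by
    simpa using hB.posSemidef.dotProduct_mulVec_nonneg (x - k • y)
  simp only [mulVec_sub, mulVec_smul, sub_dotProduct, dotProduct_sub, smul_dotProduct,
    dotProduct_smul, smul_eq_mul, hsymm] at h
  linarith

/-- If `a(x, x) ≤ k a(x, y)` then `a(x, y) ≤ k a(y, y)`. -/
theorem Matrix.PosDef.dotProduct_mulVec_le_of_self_le {n : Type*} [Fintype n]
    {B : Matrix n n ℝ} (hB : B.PosDef) {x y : n → ℝ} {k : ℝ} (hk : 0 < k)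
    (h : x ⬝ᵥ (B *ᵥ x) ≤ k * (x ⬝ᵥ (B *ᵥ y))) :
    x ⬝ᵥ (B *ᵥ y) ≤ k * (y ⬝ᵥ (B *ᵥ y)) := by
  have hY := hB.two_mul_dotProduct_mulVec_le x y k
  refine le_of_mul_le_mul_left (a := k) ?_ hk
  linarith

/-- Strengthened Cauchy–Schwarz inequalities bound the energy of a sum by the sum of energies. -/
theorem Matrix.PosDef.sum_dotProduct_mulVec_sum_le {n ι : Type*} [Fintype n] [Fintype ι]
    {A : Matrix n n ℝ} (hA : A.PosDef) (t : ι → n → ℝ) (ε : Matrix ι ι ℝ) (μ : ℝ)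
    (hCS : ∀ i j, t i ⬝ᵥ (A *ᵥ t j) ≤
      ε i j * Real.sqrt (t i ⬝ᵥ (A *ᵥ t i)) * Real.sqrt (t j ⬝ᵥ (A *ᵥ t j)))
    (hμε : ∀ x : ι → ℝ, x ⬝ᵥ (ε *ᵥ x) ≤ μ * (x ⬝ᵥ x)) :
    (∑ i, t i) ⬝ᵥ (A *ᵥ ∑ i, t i) ≤ μ * ∑ i, t i ⬝ᵥ (A *ᵥ t i) := by
  have hnn (i : ι) : 0 ≤ t i ⬝ᵥ (A *ᵥ t i) := by
    simpa using hA.posSemidef.dotProduct_mulVec_nonneg (t i)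
  set r : ι → ℝ := fun i => Real.sqrt (t i ⬝ᵥ (A *ᵥ t i))
  calc (∑ i, t i) ⬝ᵥ (A *ᵥ ∑ i, t i) = ∑ i, ∑ j, t i ⬝ᵥ (A *ᵥ t j) := by
        rw [mulVec_sum, sum_dotProduct]
        exact Finset.sum_congr rfl fun i _ => dotProduct_sum _ _ _
    _ ≤ ∑ i, ∑ j, ε i j * r i * r j :=
        Finset.sum_le_sum fun i _ => Finset.sum_le_sum fun j _ => hCS i j
    _ = r ⬝ᵥ (ε *ᵥ r) := by
        simp only [dotProduct, mulVec, Finset.mul_sum]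
        exact Finset.sum_congr rfl fun i _ => Finset.sum_congr rfl fun j _ => by ring
    _ ≤ μ * (r ⬝ᵥ r) := hμε r
    _ = μ * ∑ i, t i ⬝ᵥ (A *ᵥ t i) := by
        congr 1
        exact Finset.sum_congr rfl fun i _ => Real.mul_self_sqrt (hnn i)

/-- abstract additive Schwarz condition number bound. Under
(i) the stable decomposition with constant `C0²`, (ii) strengthened
Cauchy–Schwarz inequalities among the local spaces (indices `1,…,N`) with a
spectral-radius bound `μ` for the matrix `ε`, and (iii) local stability with
constant `ω`, the additive Schwarz operator `T = Σ_i R_iᵀ Ã_i⁻¹ R_i A`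
satisfies `C0⁻² a(u,u) ≤ a(Tu,u) ≤ ω (μ+1) a(u,u)`. -/
theorem abstract_additive_schwarz_bound
    {n N : ℕ} (A : Matrix (Fin n) (Fin n) ℝ) (hA : A.PosDef)
    (m : Fin (N + 1) → ℕ)
    (Ai : ∀ i, Matrix (Fin (m i)) (Fin (m i)) ℝ) (hAi : ∀ i, (Ai i).PosDef)
    (RT : ∀ i, Matrix (Fin n) (Fin (m i)) ℝ)
    (C0 ω μ : ℝ) (hC0 : 0 < C0) (hω : 0 < ω) (hμ : 0 < μ)
    (ε : Matrix (Fin N) (Fin N) ℝ)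
    (hdecomp : ∀ u : Fin n → ℝ, ∃ ui : (i : Fin (N + 1)) → Fin (m i) → ℝ,
      u = ∑ i, RT i *ᵥ ui i ∧
        ∑ i, ui i ⬝ᵥ (Ai i *ᵥ ui i) ≤ C0 ^ 2 * (u ⬝ᵥ (A *ᵥ u)))
    (hCS : ∀ (i j : Fin N) (ui : Fin (m i.succ) → ℝ) (uj : Fin (m j.succ) → ℝ),
      |(RT i.succ *ᵥ ui) ⬝ᵥ (A *ᵥ (RT j.succ *ᵥ uj))| ≤
        ε i j * Real.sqrt ((RT i.succ *ᵥ ui) ⬝ᵥ (A *ᵥ (RT i.succ *ᵥ ui))) *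
          Real.sqrt ((RT j.succ *ᵥ uj) ⬝ᵥ (A *ᵥ (RT j.succ *ᵥ uj))))
    (hμε : ∀ x : Fin N → ℝ, x ⬝ᵥ (ε *ᵥ x) ≤ μ * (x ⬝ᵥ x))
    (hloc : ∀ (i : Fin (N + 1)) (ui : Fin (m i) → ℝ),
      (RT i *ᵥ ui) ⬝ᵥ (A *ᵥ (RT i *ᵥ ui)) ≤ ω * (ui ⬝ᵥ (Ai i *ᵥ ui))) :
    ∀ u : Fin n → ℝ,
      C0⁻¹ ^ 2 * (u ⬝ᵥ (A *ᵥ u)) ≤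
          ((∑ i, RT i * (Ai i)⁻¹ * (RT i)ᵀ * A) *ᵥ u) ⬝ᵥ (A *ᵥ u) ∧
        ((∑ i, RT i * (Ai i)⁻¹ * (RT i)ᵀ * A) *ᵥ u) ⬝ᵥ (A *ᵥ u) ≤
          ω * (μ + 1) * (u ⬝ᵥ (A *ᵥ u)) := by
  intro u
  set w : ∀ i, Fin (m i) → ℝ := fun i => (Ai i)⁻¹ *ᵥ ((RT i)ᵀ *ᵥ (A *ᵥ u)) with hw
  have hproj (i : Fin (N + 1)) (v : Fin (m i) → ℝ) :
      (RT i *ᵥ v) ⬝ᵥ (A *ᵥ u) = v ⬝ᵥ (Ai i *ᵥ w i) := by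
    have hdet : IsUnit (Ai i).det := (hAi i).det_pos.ne'.isUnit
    rw [hw, mulVec_mulVec, mul_nonsing_inv _ hdet, one_mulVec, dotProduct_mulVec v,
      vecMul_transpose]
  have hT : (∑ i, RT i * (Ai i)⁻¹ * (RT i)ᵀ * A) *ᵥ u = ∑ i, RT i *ᵥ w i := by
    simp only [sum_mulVec, hw, mulVec_mulVec, Matrix.mul_assoc]
  have hself (i : Fin (N + 1)) : (RT i *ᵥ w i) ⬝ᵥ (A *ᵥ (RT i *ᵥ w i)) ≤
      ω * ((RT i *ᵥ w i) ⬝ᵥ (A *ᵥ u)) := by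
    rw [hproj]
    exact hloc i (w i)
  rw [hT]
  constructor
  · obtain ⟨v, hv, hle⟩ := hdecomp u
    have hu : u ⬝ᵥ (A *ᵥ u) = ∑ i, v i ⬝ᵥ (Ai i *ᵥ w i) := by
      conv_lhs => rw [hv, sum_dotProduct]
      rw [← hv]
      exact Finset.sum_congr rfl fun i _ => hproj i (v i)
    have hY : 2 * C0 ^ 2 * (u ⬝ᵥ (A *ᵥ u)) ≤
        C0 ^ 2 * (u ⬝ᵥ (A *ᵥ u)) + (C0 ^ 2) ^ 2 * ∑ i, w i ⬝ᵥ (Ai i *ᵥ w i) :=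
      calc 2 * C0 ^ 2 * (u ⬝ᵥ (A *ᵥ u))
          = ∑ i, 2 * C0 ^ 2 * (v i ⬝ᵥ (Ai i *ᵥ w i)) := by rw [hu, Finset.mul_sum]
        _ ≤ ∑ i, (v i ⬝ᵥ (Ai i *ᵥ v i) + (C0 ^ 2) ^ 2 * (w i ⬝ᵥ (Ai i *ᵥ w i))) :=
            Finset.sum_le_sum fun i _ => (hAi i).two_mul_dotProduct_mulVec_le _ _ _
        _ ≤ _ := by
            rw [Finset.sum_add_distrib, ← Finset.mul_sum]
            gcongr
    have hC : 0 < C0 ^ 2 := by positivity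
    rw [sum_dotProduct, Finset.sum_congr rfl fun i _ => hproj i (w i), inv_pow,
      inv_mul_le_iff₀ hC]
    refine le_of_mul_le_mul_left (a := C0 ^ 2) ?_ hC
    linarith
  · have hcoarse := hA.dotProduct_mulVec_le_of_self_le hω (hself 0)
    have hlocal : (∑ i : Fin N, RT i.succ *ᵥ w i.succ) ⬝ᵥ (A *ᵥ u) ≤
        μ * ω * (u ⬝ᵥ (A *ᵥ u)) := by
      refine hA.dotProduct_mulVec_le_of_self_le (mul_pos hμ hω) ?_
      refine (hA.sum_dotProduct_mulVec_sum_le _ ε μ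
        (fun i j => (le_abs_self _).trans (hCS i j _ _)) hμε).trans ?_
      rw [sum_dotProduct, mul_assoc, Finset.mul_sum (a := ω)]
      gcongr with i
      exact hself i.succ
    rw [Fin.sum_univ_succ, add_dotProduct]
    linarith
end
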